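/- arXiv:2112.14354 — 2 statements merged into one kernel-verified Lean document; each statement's English description precedes it below -/
import Mathlib

section
/- Let n ≥ 1, let λ be a C-partition of n, and assume |μ(λ)| ≠ 2. Set d(λ) = ((λ^t)^+)_B, the B-collapse of (λ^t)^+. Then μ(λ) ⊆ d(λ). -/
namespace WFPaper

/-- The list of parts of a partition (multiset of positive integers) in weakly
decreasing order. -/
def sortedDesc (s : Multiset ℕ) : List ℕ := (s.sort (· ≤ ·)).reverse

/-- The `j`-th largest part of `s` (1-indexed); `0` if `j = 0` or `j > #s`. -/
def part (s : Multiset ℕ) (j : ℕ) : ℕ := (sortedDesc s).getD (j - 1) 0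

/-- The smallest part of `s` (`0` if `s` is empty). -/
def minPart (s : Multiset ℕ) : ℕ := (s.sort (· ≤ ·)).getD 0 0

/-- Sum of the `j` largest parts of `s`. -/
def psum (s : Multiset ℕ) (j : ℕ) : ℕ := ((sortedDesc s).take j).sum

/-- Dominance order: `DomLE a b` means `a ≤ b` in the dominance order, i.e.
for every `j` the sum of the `j` largest parts of `a` is at most that of `b`. -/
def DomLE (a b : Multiset ℕ) : Prop := ∀ j, psum a j ≤ psum b j

/-- All parts are positive. -/
def PosParts (s : Multiset ℕ) : Prop := ∀ x ∈ s, 0 < x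

/-- A partition of an odd number in which every even part has even multiplicity
(a B-partition of `n` when the sum is `2*n+1`). -/
def IsTypeB (s : Multiset ℕ) : Prop :=
  PosParts s ∧ Odd s.sum ∧ ∀ x, Even x → Even (s.count x)

/-- A partition of an even number in which every odd part has even multiplicity
(a C-partition of `n` when the sum is `2*n`). -/
def IsTypeC (s : Multiset ℕ) : Prop :=
  PosParts s ∧ Even s.sum ∧ ∀ x, Odd x → Even (s.count x)

/-- A partition of an even number in which every even part has even multiplicity
(a D-partition of `n` when the sum is `2*n`). -/
def IsTypeD (s : Multiset ℕ) : Prop :=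
  PosParts s ∧ Even s.sum ∧ ∀ x, Even x → Even (s.count x)

/-- `IsCollapse T α β` : `β` is the dominance-largest partition of class `T` of
the same number as `α` which is dominated by `α` (e.g. the B/C/D-collapse of `α`
for `T = IsTypeB/IsTypeC/IsTypeD`). -/
def IsCollapse (T : Multiset ℕ → Prop) (α β : Multiset ℕ) : Prop :=
  T β ∧ β.sum = α.sum ∧ DomLE β α ∧
    ∀ γ, T γ → γ.sum = α.sum → DomLE γ α → DomLE γ β

/-- The transpose (conjugate) partition: its `j`-th part (0-indexed `j`) is the
number of parts of `s` that are `≥ j+1`. -/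
def transpose (s : Multiset ℕ) : Multiset ℕ :=
  (Multiset.range (part s 1)).map (fun j => (s.filter (fun x => j + 1 ≤ x)).card)

/-- `λ⁻` : subtract 1 from the smallest part (the part being deleted if it
becomes 0). -/
def decMin (s : Multiset ℕ) : Multiset ℕ :=
  ((minPart s - 1) ::ₘ s.erase (minPart s)).filter (fun x => 0 < x)

/-- `λ⁺` : add 1 to the largest part. -/
def incMax (s : Multiset ℕ) : Multiset ℕ :=
  (part s 1 + 1) ::ₘ s.erase (part s 1)

/-- The subpartition `μ` of `T` whose multiplicity at an even `x` is 2 if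
`m_T(x)` is even and nonzero, 1 if `m_T(x)` is odd, and 0 at odd `x`. -/
def muEven (T : Multiset ℕ) : Multiset ℕ :=
  (T.toFinset.filter (fun x => Even x)).val.bind
    (fun x => Multiset.replicate (if Even (T.count x) then 2 else 1) x)

/-- The subpartition `μ` of `T` whose multiplicity at an odd `x` is 2 if
`m_T(x)` is even and nonzero, 1 if `m_T(x)` is odd, and 0 at even `x`. -/
def muOdd (T : Multiset ℕ) : Multiset ℕ :=
  (T.toFinset.filter (fun x => Odd x)).val.bind
    (fun x => Multiset.replicate (if Even (T.count x) then 2 else 1) x)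

/-- The subpartition `π` of `T` consisting of the even parts of `T` of odd
multiplicity, each taken once. -/
def piEven (T : Multiset ℕ) : Multiset ℕ :=
  (T.toFinset.filter (fun x => Even x ∧ Odd (T.count x))).val

/-- `k` is a (1-indexed) position of an odd part of `s`. -/
def OddIdx (s : Multiset ℕ) (k : ℕ) : Prop := 1 ≤ k ∧ Odd (part s k)

/-- `k` is a (1-indexed) position of an even part of `s`. -/
def EvenIdx (s : Multiset ℕ) (k : ℕ) : Prop :=
  1 ≤ k ∧ k ≤ Multiset.card s ∧ Even (part s k)

/-- `e_s(i,j)` : number of positions `i ≤ k ≤ j` with `s_k` even. -/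
def eCount (s : Multiset ℕ) (i j : ℕ) : ℕ :=
  ((Finset.Icc i j).filter (fun k => Even (part s k))).card

/-- number of positions `i ≤ k ≤ j` with `s_k` odd. -/
def oCount (s : Multiset ℕ) (i j : ℕ) : ℕ :=
  ((Finset.Icc i j).filter (fun k => Odd (part s k))).card

/-- `s` is special in the e-count sense: `e_s(1,t₁)` is even, and
`e_s(tᵢ,tᵢ₊₁)` is even for all `1 ≤ i ≤ p-1`, where `t₁ < ⋯ < t_p` are the
positions of the odd parts of `s`. -/
def IsSpecialE (s : Multiset ℕ) : Prop :=
  (∀ t, OddIdx s t → (∀ t', OddIdx s t' → t ≤ t') → Even (eCount s 1 t)) ∧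
  (∀ i j, OddIdx s i → OddIdx s j → i < j →
    (∀ k, OddIdx s k → k ≤ i ∨ j ≤ k) → Even (eCount s i j))

/-- `s` is quasi-special: `e_s(1,t₁)` is even, `e_s(tᵢ,tᵢ₊₁)` is even for all
`1 ≤ i ≤ p-2`, and the smallest part of `s` is odd with multiplicity 1. -/
def IsQuasiSpecialE (s : Multiset ℕ) : Prop :=
  (∀ t, OddIdx s t → (∀ t', OddIdx s t' → t ≤ t') → Even (eCount s 1 t)) ∧
  (∀ i j, OddIdx s i → OddIdx s j → i < j →
    (∀ k, OddIdx s k → k ≤ i ∨ j ≤ k) → (∃ k, OddIdx s k ∧ j < k) →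
      Even (eCount s i j)) ∧
  Odd (minPart s) ∧ s.count (minPart s) = 1

/-- Number of odd parts greater than every even part (equals the number of odd
parts greater than the largest even part, and the number of all odd parts if
there are no even parts). -/
def numOddDominant (s : Multiset ℕ) : ℕ :=
  (s.filter (fun x => Odd x ∧ ∀ y ∈ s, Even y → y < x)).card

/-- Between every pair of consecutive even parts of `s` (in the decreasing
listing of the parts) there is an even number of odd parts. -/
def EvenBetween (s : Multiset ℕ) : Prop :=
  ∀ i j, EvenIdx s i → EvenIdx s j → i < j →
    (∀ k, EvenIdx s k → k ≤ i ∨ j ≤ k) → Even (oCount s i j)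

/-- A special B-partition. -/
def IsSpecialTypeB (s : Multiset ℕ) : Prop :=
  IsTypeB s ∧ EvenBetween s ∧ Odd (numOddDominant s)

/-- A special D-partition. -/
def IsSpecialTypeD (s : Multiset ℕ) : Prop :=
  IsTypeD s ∧ EvenBetween s ∧ Even (numOddDominant s)

/-! ### Partitions as antitone sequences -/

theorem sortedDesc_map_range {f : ℕ → ℕ} (hf : Antitone f) (N : ℕ) :
    sortedDesc ((Multiset.range N).map f) = (List.range N).map f := by
  have hsorted : ((List.range N).map f).reverse.Pairwise (· ≤ ·) := by
    rw [List.pairwise_reverse, List.pairwise_map]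
    exact List.pairwise_lt_range.imp fun h => hf h.le
  have hperm : (((Multiset.range N).map f).sort (· ≤ ·)).Perm ((List.range N).map f).reverse := by
    rw [← Multiset.coe_eq_coe, Multiset.sort_eq, Multiset.coe_reverse]
    rfl
  rw [sortedDesc, hperm.eq_of_pairwise' (Multiset.pairwise_sort _ _) hsorted, List.reverse_reverse]

theorem sum_map_range_eq_of_le {f : ℕ → ℕ} {N J : ℕ} (h0 : ∀ k, N ≤ k → f k = 0) (h : N ≤ J) :
    ((Multiset.range N).map f).sum = ∑ k ∈ Finset.range J, f k := by
  change ∑ k ∈ Finset.range N, f k = _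
  refine Finset.sum_subset (Finset.range_mono h) fun k _ hk => h0 k ?_
  simpa using hk

theorem psum_map_range {f : ℕ → ℕ} (hf : Antitone f) {N : ℕ} (h0 : ∀ k, N ≤ k → f k = 0) (j : ℕ) :
    psum ((Multiset.range N).map f) j = ∑ k ∈ Finset.range j, f k := by
  rw [psum, sortedDesc_map_range hf, ← List.map_take, List.take_range]
  change ∑ k ∈ Finset.range (min j N), f k = _
  refine Finset.sum_subset (Finset.range_mono (min_le_left _ _)) fun k hk hk' => h0 k ?_
  simp only [Finset.mem_range] at hk hk'
  omega

/-- Every partition is the multiset of the values of an antitone sequence on its support. -/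
theorem exists_antitone_map_range {s : Multiset ℕ} (hs : PosParts s) :
    ∃ f : ℕ → ℕ, ∃ N, Antitone f ∧ (∀ k, k < N ↔ 0 < f k) ∧ s = (Multiset.range N).map f := by
  have hcoe : (sortedDesc s : Multiset ℕ) = s := by
    rw [sortedDesc, Multiset.coe_reverse, Multiset.sort_eq]
  have hsorted : (sortedDesc s).Pairwise (· ≥ ·) := by
    rw [sortedDesc, List.pairwise_reverse]
    exact Multiset.pairwise_sort _ _
  set L := sortedDesc s
  have hval : ∀ k, (hk : k < L.length) → L.getD k 0 = L[k] := fun k hk => by simp [hk]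
  have hzero : ∀ k, L.length ≤ k → L.getD k 0 = 0 := fun k hk => by simp [hk]
  refine ⟨fun k => L.getD k 0, L.length, ?_, ?_, ?_⟩
  · intro i j hij
    dsimp only
    rcases le_or_gt L.length j with hj | hj
    · rw [hzero j hj]
      exact Nat.zero_le _
    · rw [hval j hj, hval i (hij.trans_lt hj)]
      rcases hij.eq_or_lt with rfl | h
      · exact le_rfl
      · exact List.pairwise_iff_getElem.1 hsorted i j _ _ h
  · intro k
    constructor
    · intro hk
      dsimp only
      rw [hval k hk]
      refine hs _ ?_
      rw [← hcoe]
      exact Multiset.mem_coe.2 (List.getElem_mem hk)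
    · intro hk
      by_contra h
      exact hk.ne' (hzero k (not_lt.1 h))
  · rw [← hcoe]
    change (L : Multiset ℕ) = (((List.range L.length).map fun k => L.getD k 0 : List ℕ) : Multiset ℕ)
    congr 1
    refine List.ext_getElem (by simp) fun k hk _ => ?_
    simp [hk]

theorem count_map_range (f : ℕ → ℕ) (N x : ℕ) :
    ((Multiset.range N).map f).count x = ((Finset.range N).filter fun k => x = f k).card := by
  rw [Multiset.count_map]
  rfl

theorem exists_support_of_antitone {f : ℕ → ℕ} (hf : Antitone f) {K : ℕ} (hK : f K = 0) :
    ∃ M ≤ K, ∀ k, k < M ↔ 0 < f k := by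
  classical
  have hex : ∃ k, f k = 0 := ⟨K, hK⟩
  refine ⟨Nat.find hex, Nat.find_min' hex hK, fun k => ⟨fun hk => ?_, fun hk => ?_⟩⟩
  · exact Nat.pos_of_ne_zero (Nat.find_min hex hk)
  · by_contra h
    have h1 := hf (not_lt.1 h)
    have h2 := Nat.find_spec hex
    omega

/-! ### Partitions of type B -/

theorem even_sum_add_card {s : Multiset ℕ} (hs : ∀ x, Even x → Even (s.count x)) :
    Even (s.sum + Multiset.card s) := by
  rw [Finset.sum_multiset_count, ← Multiset.toFinset_sum_count_eq, ← Finset.sum_add_distrib]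
  refine Finset.even_sum _ fun x _ => ?_
  rcases Nat.even_or_odd x with hx | hx
  · have := hs x hx
    rw [smul_eq_mul]
    exact (this.mul_right _).add this
  · rw [smul_eq_mul, ← Nat.mul_succ]
    exact (hx.add_odd odd_one).mul_left _

/-- In a partition of type B, a partial sum at a descent has the parity of the number of terms. -/
theorem even_sum_range_add_of_descent {e : ℕ → ℕ} {M : ℕ} (he : Antitone e)
    (hM : ∀ k, k < M ↔ 0 < e k)
    (hB : ∀ x, Even x → Even (((Multiset.range M).map e).count x)) {j : ℕ}
    (hj : e (j + 1) < e j) : Even (∑ k ∈ Finset.range (j + 1), e k + (j + 1)) := by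
  have hjM : j < M := (hM j).2 (by omega)
  have := even_sum_add_card (s := (Multiset.range (j + 1)).map e) ?_
  · rwa [Multiset.card_map, Multiset.card_range] at this
  · intro x hx
    rcases le_or_gt (e j) x with h | h
    · have hcount : ((Multiset.range (j + 1)).map e).count x
          = ((Multiset.range M).map e).count x := by
        rw [count_map_range, count_map_range]
        congr 1
        ext k
        simp only [Finset.mem_filter, Finset.mem_range]
        constructor
        · rintro ⟨h1, h2⟩
          exact ⟨by omega, h2⟩
        · rintro ⟨h1, h2⟩
          refine ⟨?_, h2⟩
          by_contra h3
          have := he (show j + 1 ≤ k by omega)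
          omega
      rw [hcount]
      exact hB x hx
    · have : ((Multiset.range (j + 1)).map e).count x = 0 := by
        rw [Multiset.count_eq_zero, Multiset.mem_map]
        rintro ⟨k, hk, rfl⟩
        rw [Multiset.mem_range] at hk
        have := he (show k ≤ j by omega)
        omega
      rw [this]
      exact Even.zero

/-- A type B sequence `e` dominated by `a` has a strictly smaller partial sum wherever the
partial sum of `a` has the wrong parity, next to an odd term of `a`. -/
theorem sum_range_lt_of_odd {a e : ℕ → ℕ} (ha : Antitone a) {K : ℕ} (haK : a K = 0)
    (he : ∀ j, e (j + 1) ≠ e j → Even (∑ k ∈ Finset.range (j + 1), e k + (j + 1)))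
    (hle : ∀ j, ∑ k ∈ Finset.range j, e k ≤ ∑ k ∈ Finset.range j, a k) {j : ℕ}
    (hbad : Odd (∑ k ∈ Finset.range (j + 1), a k + (j + 1))) (hodd : Odd (a j) ∨ Odd (a (j + 1))) :
    ∑ k ∈ Finset.range (j + 1), e k < ∑ k ∈ Finset.range (j + 1), a k := by
  have step : ∀ j, ∑ k ∈ Finset.range (j + 1), e k = ∑ k ∈ Finset.range (j + 1), a k →
      Odd (∑ k ∈ Finset.range (j + 1), a k + (j + 1)) →
      a (j + 1) = a j ∧
        ∑ k ∈ Finset.range (j + 2), e k = ∑ k ∈ Finset.range (j + 2), a k := by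
    intro j heq hbad
    have hej : e (j + 1) = e j := by
      by_contra h
      have := he j h
      rw [heq] at this
      exact (Nat.not_even_iff_odd.2 hbad) this
    have h1 := hle j
    have h2 := hle (j + 2)
    have h3 := ha (Nat.le_succ j)
    simp only [Finset.sum_range_succ, Nat.succ_eq_add_one] at heq h2 h3 ⊢
    omega
  by_contra hlt
  have heq := le_antisymm (hle (j + 1)) (not_lt.1 hlt)
  have hodd' : Odd (a j) := hodd.elim id fun h => (step j heq hbad).1 ▸ h
  have key : ∀ m, a (j + m) = a j ∧
      ∑ k ∈ Finset.range (j + m + 1), e k = ∑ k ∈ Finset.range (j + m + 1), a k ∧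
      Odd (∑ k ∈ Finset.range (j + m + 1), a k + (j + m + 1)) := by
    intro m
    induction m with
    | zero => exact ⟨rfl, heq, hbad⟩
    | succ m ih =>
      obtain ⟨h1, h2, h3⟩ := ih
      obtain ⟨h4, h5⟩ := step (j + m) h2 h3
      refine ⟨h4.trans h1, h5, ?_⟩
      have h6 : Odd (a (j + m + 1)) := by rwa [h4, h1]
      rw [← add_assoc j m 1, Finset.sum_range_succ _ (j + m + 1)]
      rw [Nat.odd_iff] at h3 h6 ⊢
      omega
  have h1 := (key K).1
  have h2 := ha (Nat.le_add_left K j)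
  rw [Nat.odd_iff] at hodd'
  omega

/-! ### The collapse of `g⁺` for a sequence `g` with `g (2 * i) ≡ g (2 * i + 1)` -/

/-- The sequence `g` with its first term increased by one. -/
def incHead (g : ℕ → ℕ) (k : ℕ) : ℕ := if k = 0 then g 0 + 1 else g k

theorem incHead_zero (g : ℕ → ℕ) : incHead g 0 = g 0 + 1 := rfl

theorem incHead_succ (g : ℕ → ℕ) (k : ℕ) : incHead g (k + 1) = g (k + 1) := rfl

theorem antitone_incHead {g : ℕ → ℕ} (hg : Antitone g) : Antitone (incHead g) := by
  refine antitone_nat_of_succ_le fun k => ?_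
  have := hg (Nat.le_succ k)
  simp only [incHead, Nat.succ_eq_add_one] at this ⊢
  split_ifs <;> simp_all; omega

/-- The explicit B-collapse of `incHead g`: odd terms of `g` are kept, and an even term of `g`
moves by one towards its neighbour whenever it differs from it, the terms being grouped
as `0 | 1, 2 | 3, 4 | …`. -/
def collapseSeq (g : ℕ → ℕ) (k : ℕ) : ℕ :=
  if g k % 2 = 1 then g k
  else if k = 0 then g k + 1
  else if k % 2 = 1 then (if g (k + 1) < g k then g k - 1 else g k)
  else (if g k < g (k - 1) then g k + 1 else g k)

theorem collapseSeq_zero (g : ℕ → ℕ) :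
    collapseSeq g 0 = if g 0 % 2 = 1 then g 0 else g 0 + 1 := by
  simp [collapseSeq]

theorem collapseSeq_odd (g : ℕ → ℕ) (i : ℕ) :
    collapseSeq g (2 * i + 1) = if g (2 * i + 1) % 2 = 1 then g (2 * i + 1)
      else if g (2 * i + 2) < g (2 * i + 1) then g (2 * i + 1) - 1 else g (2 * i + 1) := by
  have h : (2 * i + 1) % 2 = 1 := by omega
  simp [collapseSeq, h]

theorem collapseSeq_even (g : ℕ → ℕ) (i : ℕ) :
    collapseSeq g (2 * i + 2) = if g (2 * i + 2) % 2 = 1 then g (2 * i + 2)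
      else if g (2 * i + 2) < g (2 * i + 1) then g (2 * i + 2) + 1 else g (2 * i + 2) := by
  simp [collapseSeq]

theorem antitone_collapseSeq {g : ℕ → ℕ} (hg : Antitone g)
    (hpar : ∀ i, g (2 * i) % 2 = g (2 * i + 1) % 2) : Antitone (collapseSeq g) := by
  refine antitone_nat_of_succ_le fun k => ?_
  have h1 := hg (Nat.le_succ k)
  simp only [Nat.succ_eq_add_one] at h1
  rcases Nat.even_or_odd' k with ⟨i, rfl | rfl⟩
  · have h2 := hpar i
    rw [collapseSeq_odd]
    rcases i with _ | i
    · simp only [mul_zero, zero_add] at *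
      rw [collapseSeq_zero]
      split_ifs <;> omega
    · rw [show 2 * (i + 1) = 2 * i + 2 by ring] at *
      rw [collapseSeq_even]
      split_ifs <;> omega
  · rw [show 2 * i + 1 + 1 = 2 * i + 2 by ring] at *
    rw [collapseSeq_even, collapseSeq_odd]
    split_ifs <;> omega

theorem sum_incHead_odd {g : ℕ → ℕ} (hpar : ∀ i, g (2 * i) % 2 = g (2 * i + 1) % 2) (i : ℕ) :
    (∑ k ∈ Finset.range (2 * i + 1), incHead g k) % 2 = (1 + g (2 * i)) % 2 := by
  induction i with
  | zero => simp [incHead_zero, add_comm]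
  | succ i ih =>
    have h := hpar i
    rw [show 2 * (i + 1) = 2 * i + 2 by ring, Finset.sum_range_succ, Finset.sum_range_succ,
      incHead_succ, incHead_succ, show 2 * i + 1 + 1 = 2 * i + 2 from rfl]
    omega

theorem sum_collapseSeq_odd {g : ℕ → ℕ} (hg : Antitone g)
    (hpar : ∀ i, g (2 * i) % 2 = g (2 * i + 1) % 2) (i : ℕ) :
    ∑ k ∈ Finset.range (2 * i + 1), collapseSeq g k + g (2 * i) % 2
      = ∑ k ∈ Finset.range (2 * i + 1), incHead g k := by
  induction i with
  | zero =>
    simp only [mul_zero, zero_add, Finset.range_one, Finset.sum_singleton, incHead_zero,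
      collapseSeq_zero]
    split_ifs <;> omega
  | succ i ih =>
    have h := hpar i
    have h1 : g (2 * i + 2) ≤ g (2 * i + 1) := hg (by omega)
    rw [show 2 * (i + 1) = 2 * i + 2 by ring, Finset.sum_range_succ, Finset.sum_range_succ,
      Finset.sum_range_succ (incHead g), Finset.sum_range_succ (incHead g),
      incHead_succ, incHead_succ, show 2 * i + 1 + 1 = 2 * i + 2 from rfl, collapseSeq_even,
      collapseSeq_odd]
    split_ifs <;> omega

theorem sum_collapseSeq_bounds {g : ℕ → ℕ} (hg : Antitone g)
    (hpar : ∀ i, g (2 * i) % 2 = g (2 * i + 1) % 2) (j : ℕ) :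
    ∑ k ∈ Finset.range j, collapseSeq g k ≤ ∑ k ∈ Finset.range j, incHead g k ∧
    ∑ k ∈ Finset.range j, incHead g k ≤ ∑ k ∈ Finset.range j, collapseSeq g k + 1 := by
  rcases Nat.even_or_odd' j with ⟨i, rfl | rfl⟩
  · rcases i with _ | i
    · simp
    · have h := sum_collapseSeq_odd hg hpar i
      have h1 := hpar i
      rw [show 2 * (i + 1) = 2 * i + 1 + 1 by ring, Finset.sum_range_succ,
        Finset.sum_range_succ (incHead g), incHead_succ, collapseSeq_odd]
      split_ifs <;> omega
  · have h := sum_collapseSeq_odd hg hpar i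
    omega

theorem even_count_collapseSeq {g : ℕ → ℕ} (hg : Antitone g) {x : ℕ} (hx : Even x) (K : ℕ) :
    Even (((Multiset.range (2 * K + 1)).map (collapseSeq g)).count x) := by
  rw [Nat.even_iff] at hx
  induction K with
  | zero =>
    have : x ≠ collapseSeq g 0 := by
      rw [collapseSeq_zero]
      split_ifs <;> omega
    simp [this]
  | succ K ih =>
    rw [show 2 * (K + 1) + 1 = 2 * K + 1 + 1 + 1 by ring, Multiset.range_succ, Multiset.range_succ,
      Multiset.map_cons, Multiset.map_cons, Multiset.count_cons, Multiset.count_cons, add_assoc]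
    refine ih.add ?_
    by_cases h : collapseSeq g (2 * K + 1) = collapseSeq g (2 * K + 1 + 1)
    · rw [h]
      exact Even.add_self _
    · have h1 : x ≠ collapseSeq g (2 * K + 1) ∧ x ≠ collapseSeq g (2 * K + 1 + 1) := by
        have hK : g (2 * K + 2) ≤ g (2 * K + 1) := hg (by omega)
        rw [show 2 * K + 1 + 1 = 2 * K + 2 by ring, collapseSeq_odd, collapseSeq_even] at *
        split_ifs at h ⊢ <;> omega
      simp [h1]

/-- There is a type B partition whose partial sums are within one of those of `incHead g`. -/
theorem exists_isTypeB_near_incHead {g : ℕ → ℕ} (hg : Antitone g) {N : ℕ} (hN : 0 < N)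
    (h0 : ∀ k, N ≤ k → g k = 0) (hpar : ∀ i, g (2 * i) % 2 = g (2 * i + 1) % 2) :
    ∃ s, IsTypeB s ∧ s.sum = ((Multiset.range N).map (incHead g)).sum ∧
      ∀ j, psum s j ≤ ∑ k ∈ Finset.range j, incHead g k ∧
        ∑ k ∈ Finset.range j, incHead g k ≤ psum s j + 1 := by
  have hc := antitone_collapseSeq hg hpar
  have hcK : collapseSeq g (2 * N + 1) = 0 := by
    rw [collapseSeq_odd, h0 (2 * N + 1) (by omega), h0 (2 * N + 2) (by omega)]
    simp
  obtain ⟨M, hMK, hM⟩ := exists_support_of_antitone hc hcK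
  have hM0 : ∀ k, M ≤ k → collapseSeq g k = 0 := fun k hk => by
    have := hM k
    omega
  have ha0 : ∀ k, N ≤ k → incHead g k = 0 := fun k hk => by
    rw [incHead, if_neg (by omega), h0 k hk]
  have hsum : ((Multiset.range M).map (collapseSeq g)).sum
      = ∑ k ∈ Finset.range (2 * N + 1), incHead g k := by
    rw [sum_map_range_eq_of_le hM0 hMK, ← sum_collapseSeq_odd hg hpar, h0 (2 * N) (by omega),
      Nat.zero_mod, add_zero]
  refine ⟨(Multiset.range M).map (collapseSeq g), ⟨?_, ?_, ?_⟩, ?_, ?_⟩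
  · intro x hx
    obtain ⟨k, hk, rfl⟩ := Multiset.mem_map.1 hx
    exact (hM k).1 (Multiset.mem_range.1 hk)
  · rw [hsum, Nat.odd_iff, sum_incHead_odd hpar, h0 (2 * N) (by omega)]
  · intro x hx
    rcases Nat.eq_zero_or_pos x with rfl | hpos
    · have : ((Multiset.range M).map (collapseSeq g)).count 0 = 0 := by
        rw [Multiset.count_eq_zero, Multiset.mem_map]
        rintro ⟨k, hk, hk0⟩
        have := (hM k).1 (Multiset.mem_range.1 hk)
        omega
      rw [this]
      exact Even.zero
    · have h := even_count_collapseSeq hg hx N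
      rw [count_map_range] at h ⊢
      convert h using 2
      ext k
      have := hM k
      simp only [Finset.mem_filter, Finset.mem_range]
      omega
  · rw [hsum, sum_map_range_eq_of_le ha0 (show N ≤ 2 * N + 1 by omega)]
  · intro j
    rw [psum_map_range hc hM0]
    exact sum_collapseSeq_bounds hg hpar j

/-- The B-collapse of `incHead g` agrees with `g` wherever `g` is odd. -/
theorem isCollapse_eq_of_odd {g e : ℕ → ℕ} {N M : ℕ} (hg : Antitone g) (hN : 0 < N)
    (h0 : ∀ k, N ≤ k → g k = 0) (hpar : ∀ i, g (2 * i) % 2 = g (2 * i + 1) % 2)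
    (he : Antitone e) (hM : ∀ k, k < M ↔ 0 < e k)
    (hd : IsCollapse IsTypeB ((Multiset.range N).map (incHead g)) ((Multiset.range M).map e))
    {k : ℕ} (hk : Odd (g k)) : e k = g k := by
  have ha := antitone_incHead hg
  have ha0 : ∀ k, N ≤ k → incHead g k = 0 := fun k hk => by
    rw [incHead, if_neg (by omega), h0 k hk]
  have hM0 : ∀ k, M ≤ k → e k = 0 := fun k hk => by
    have := hM k
    omega
  obtain ⟨hB, -, hle, hmax⟩ := hd
  obtain ⟨s, hs, hsum, hnear⟩ := exists_isTypeB_near_incHead hg hN h0 hpar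
  have hsd := hmax s hs hsum fun j => by
    rw [psum_map_range ha ha0]
    exact (hnear j).1
  have hupper : ∀ j, ∑ k ∈ Finset.range j, e k ≤ ∑ k ∈ Finset.range j, incHead g k := fun j => by
    have := hle j
    rwa [psum_map_range ha ha0, psum_map_range he hM0] at this
  have hlower : ∀ j, ∑ k ∈ Finset.range j, incHead g k ≤ ∑ k ∈ Finset.range j, e k + 1 :=
    fun j => by
      have h1 := hsd j
      have h2 := (hnear j).2
      rw [psum_map_range he hM0] at h1
      omega
  have hdesc : ∀ j, e (j + 1) ≠ e j → Even (∑ k ∈ Finset.range (j + 1), e k + (j + 1)) :=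
    fun j hj => even_sum_range_add_of_descent he hM hB.2.2
      (lt_of_le_of_ne (he (Nat.le_succ j)) hj)
  have hstrict : ∀ j, Odd (∑ k ∈ Finset.range (j + 1), incHead g k + (j + 1)) →
      Odd (incHead g j) ∨ Odd (incHead g (j + 1)) →
      ∑ k ∈ Finset.range (j + 1), incHead g k = ∑ k ∈ Finset.range (j + 1), e k + 1 :=
    fun j hbad hodd => le_antisymm (hlower _)
      (sum_range_lt_of_odd ha (ha0 N le_rfl) hdesc hupper hbad hodd)
  obtain ⟨i, hi⟩ := Nat.even_or_odd' k
  have hpi := hpar i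
  have hsi := sum_incHead_odd hpar i
  have hgi : g (2 * i) % 2 = 1 := by
    rw [Nat.odd_iff] at hk
    rcases hi with rfl | rfl <;> omega
  have hmid := hstrict (2 * i) (by rw [Nat.odd_iff]; omega)
    (Or.inr (by rw [incHead_succ, Nat.odd_iff]; omega))
  rcases hi with rfl | rfl
  · rcases i with _ | i
    · simp only [mul_zero, zero_add, Finset.range_one, Finset.sum_singleton, incHead_zero] at *
      omega
    · have hsi' := sum_incHead_odd hpar i
      have hpi' := hpar i
      rw [show 2 * (i + 1) = 2 * i + 2 by ring] at *
      have hpre := hstrict (2 * i + 1)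
        (by rw [Nat.odd_iff, Finset.sum_range_succ, incHead_succ]; omega)
        (Or.inr (by rwa [incHead_succ]))
      rw [Finset.sum_range_succ, Finset.sum_range_succ e, incHead_succ] at hmid
      rw [show 2 * i + 1 + 1 = 2 * i + 2 by ring] at *
      omega
  · have hpost := hstrict (2 * i + 1)
      (by rw [Nat.odd_iff, Finset.sum_range_succ, incHead_succ]; omega)
      (Or.inl (by rwa [incHead_succ]))
    rw [Finset.sum_range_succ, Finset.sum_range_succ e, incHead_succ] at hpost
    omega

/-! ### The transpose -/

theorem card_filter_succ_le (s : Multiset ℕ) (m : ℕ) :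
    Multiset.card (s.filter fun x => m ≤ x)
      = Multiset.card (s.filter fun x => m + 1 ≤ x) + s.count m := by
  induction s using Multiset.induction_on with
  | empty => simp
  | cons x s ih =>
    simp only [← Multiset.countP_eq_card_filter, Multiset.countP_cons, Multiset.count_cons] at ih ⊢
    split_ifs <;> omega

theorem incMax_map_range {g : ℕ → ℕ} (hg : Antitone g) {N : ℕ} (hN : 0 < N) :
    incMax ((Multiset.range N).map g) = (Multiset.range N).map (incHead g) := by
  obtain ⟨N, rfl⟩ := Nat.exists_eq_succ_of_ne_zero hN.ne'
  have hcons : ∀ f : ℕ → ℕ, (Multiset.range (N + 1)).map f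
      = f 0 ::ₘ (Multiset.range N).map fun k => f (k + 1) := fun f => by
    change (((List.range (N + 1)).map f : List ℕ) : Multiset ℕ)
      = ((f 0 :: (List.range N).map fun k => f (k + 1) : List ℕ) : Multiset ℕ)
    rw [List.range_succ_eq_map, List.map_cons, List.map_map]
    rfl
  have hpart : part ((Multiset.range (N + 1)).map g) 1 = g 0 := by
    rw [part, sortedDesc_map_range hg]
    simp [List.range_succ_eq_map]
  rw [incMax, hpart, hcons g, Multiset.erase_cons_head, hcons (incHead g)]
  rfl

theorem le_part_one {s : Multiset ℕ} (hs : PosParts s) {x : ℕ} (hx : x ∈ s) : x ≤ part s 1 := by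
  obtain ⟨f, N, hf, hN, rfl⟩ := exists_antitone_map_range hs
  obtain ⟨k, hk, rfl⟩ := Multiset.mem_map.1 hx
  rw [Multiset.mem_range] at hk
  have hpos : 0 < N := by omega
  rw [part, sortedDesc_map_range hf]
  simpa [hpos] using hf (Nat.zero_le k)

/-- `muOdd T` involves only odd parts of `T`, with at most their multiplicity. -/
theorem count_muOdd_le (T : Multiset ℕ) (x : ℕ) :
    (muOdd T).count x ≤ if Odd x then T.count x else 0 := by
  have hcount : (muOdd T).count x = ∑ y ∈ T.toFinset.filter (fun y => Odd y),
      if x = y then (if Even (T.count y) then 2 else 1) else 0 := by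
    rw [muOdd, Multiset.count_bind]
    refine Finset.sum_congr rfl fun y _ => ?_
    rw [Multiset.count_replicate]
    simp only [eq_comm]
  rw [hcount, Finset.sum_ite_eq]
  simp only [Finset.mem_filter, Multiset.mem_toFinset]
  by_cases hx : Odd x
  · by_cases hT : x ∈ T
    · have hpos := Multiset.count_pos.2 hT
      simp only [hT, hx, and_self, if_true]
      split_ifs with h
      · rw [Nat.even_iff] at h
        omega
      · omega
    · simp [hT]
  · simp [hx]

/-- For a C-partition `λ` of `n ≥ 1` with `|μ(λ)| ≠ 2` and
`d(λ) = ((λᵗ)⁺)_B`, one has `μ(λ) ⊆ d(λ)`. -/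
theorem statement6 (n : ℕ) (hn : 1 ≤ n) (l : Multiset ℕ)
    (hC : IsTypeC l ∧ l.sum = 2 * n)
    (hmu : (muOdd (transpose l)).sum ≠ 2)
    (d : Multiset ℕ) (hd : IsCollapse IsTypeB (incMax (transpose l)) d) :
    muOdd (transpose l) ≤ d := by
  obtain ⟨⟨hpos, -, hcount⟩, hsum⟩ := hC
  set N := part l 1
  set g : ℕ → ℕ := fun j => Multiset.card (l.filter fun x => j + 1 ≤ x) with hgdef
  have hT : transpose l = (Multiset.range N).map g := rfl
  have hstep : ∀ j, g j = g (j + 1) + l.count (j + 1) := fun j => by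
    exact card_filter_succ_le l (j + 1)
  have hg : Antitone g := antitone_nat_of_succ_le fun k => by
    have := hstep k
    omega
  have h0 : ∀ k, N ≤ k → g k = 0 := fun k hk => by
    rw [hgdef, Multiset.card_eq_zero, Multiset.filter_eq_nil]
    intro x hx
    have := le_part_one hpos hx
    omega
  have hN : 0 < N := by
    obtain ⟨x, hx⟩ := Multiset.exists_mem_of_ne_zero (s := l) (by rintro rfl; simp at hsum; omega)
    exact (hpos x hx).trans_le (le_part_one hpos hx)
  have hpar : ∀ i, g (2 * i) % 2 = g (2 * i + 1) % 2 := fun i => by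
    have h1 := hstep (2 * i)
    have h2 := hcount (2 * i + 1) ⟨i, rfl⟩
    rw [Nat.even_iff] at h2
    omega
  rw [hT, incMax_map_range hg hN] at hd
  rw [hT]
  obtain ⟨e, M, he, hM, rfl⟩ := exists_antitone_map_range hd.1.1
  refine Multiset.le_iff_count.2 fun x => (count_muOdd_le _ x).trans ?_
  split_ifs with hx
  · rw [count_map_range, count_map_range]
    refine Finset.card_le_card fun k hk => ?_
    simp only [Finset.mem_filter, Finset.mem_range] at hk ⊢
    obtain ⟨-, rfl⟩ := hk
    have hek := isCollapse_eq_of_odd hg hN h0 hpar he hM hd hx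
    exact ⟨(hM k).2 (hek ▸ hx.pos), hek.symm⟩
  · exact Nat.zero_le _

end WFPaper
end

section
/- Let n ≥ 1 and let λ be either a C-partition of n or a D-partition of n. Then |μ(λ)| = 2 (equivalently, μ(λ) = (1,1)) if and only if: λ_1 > λ_2, λ_1 − λ_2 is even, and λ_x = λ_{x+1} for every odd x ≥ 3, where λ_j denotes the j-th largest part of λ (with λ_j = 0 for j > #λ). Equivalently, λ has the form (λ_1, λ_2^{o_2}, λ_3^{e_3}, …, λ_k^{e_k}) in which the largest part λ_1 occurs with multiplicity one, λ_1 − λ_2 is even, the next distinct value λ_2 occurs with odd multiplicity o_2, and every smaller distinct value occurs with even multiplicity. -/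
namespace WFPaper

/-- In a weakly decreasing list, at least `x + 1` entries are `≥ c` iff the entry at index `x`
is `≥ c`. -/
theorem succ_le_countP_iff (c : ℕ) (hc : 1 ≤ c) (L : List ℕ) (hL : L.Pairwise (· ≥ ·)) (x : ℕ) :
    x + 1 ≤ L.countP (fun y => c ≤ y) ↔ c ≤ L.getD x 0 := by
  induction L generalizing x with
  | nil => simp; omega
  | cons a L ih =>
    rw [List.pairwise_cons] at hL
    by_cases ha : c ≤ a
    · rw [List.countP_cons_of_pos (by simpa using ha)]
      cases x with
      | zero => simpa using ha
      | succ x => simpa using ih hL.2 x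
    · have h0 : L.countP (fun y => c ≤ y) = 0 := by
        rw [List.countP_eq_zero]
        intro y hy
        have := hL.1 y hy
        simp only [decide_eq_true_eq]
        omega
      rw [List.countP_cons_of_neg (by simpa using ha), h0]
      cases x with
      | zero => simpa using ha
      | succ x => simpa [h0] using ih hL.2 x

theorem sortedDesc_pairwise (s : Multiset ℕ) : (sortedDesc s).Pairwise (· ≥ ·) := by
  rw [sortedDesc, List.pairwise_reverse]
  exact Multiset.pairwise_sort s (· ≤ ·)

theorem coe_sortedDesc (s : Multiset ℕ) : (sortedDesc s : Multiset ℕ) = s := by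
  rw [sortedDesc, Multiset.coe_reverse, Multiset.sort_eq]

theorem le_card_filter_iff (s : Multiset ℕ) (c x : ℕ) (hc : 1 ≤ c) (hx : 1 ≤ x) :
    x ≤ (s.filter (fun y => c ≤ y)).card ↔ c ≤ part s x := by
  obtain ⟨x, rfl⟩ := Nat.exists_eq_add_of_le' hx
  rw [part, Nat.add_sub_cancel, ← succ_le_countP_iff c hc _ (sortedDesc_pairwise s),
    ← Multiset.countP_eq_card_filter]
  conv_lhs => rw [← coe_sortedDesc s, Multiset.coe_countP]

theorem part_anti (s : Multiset ℕ) {x y : ℕ} (hx : 1 ≤ x) (hxy : x ≤ y) :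
    part s y ≤ part s x := by
  rcases Nat.eq_zero_or_pos (part s y) with h | h
  · omega
  · rw [← le_card_filter_iff s _ x h hx]
    exact hxy.trans ((le_card_filter_iff s _ y h (hx.trans hxy)).2 le_rfl)

theorem count_transpose (s : Multiset ℕ) (x : ℕ) (hx : 1 ≤ x) :
    (transpose s).count x = part s x - part s (x + 1) := by
  rw [transpose, Multiset.count_map]
  have key : (Finset.range (part s 1)).filter
      (fun j => x = (s.filter (fun y => j + 1 ≤ y)).card) =
      Finset.Ico (part s (x + 1)) (part s x) := by
    ext j
    have h1 := le_card_filter_iff s (j + 1) x (by omega) hx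
    have h2 := le_card_filter_iff s (j + 1) (x + 1) (by omega) (by omega)
    have h3 := part_anti s le_rfl hx
    simp only [Finset.mem_filter, Finset.mem_range, Finset.mem_Ico]
    omega
  rw [← Nat.card_Ico, ← key]
  rfl

theorem count_muOdd (T : Multiset ℕ) (x : ℕ) :
    (muOdd T).count x =
      if x ∈ T ∧ Odd x then (if Even (T.count x) then 2 else 1) else 0 := by
  rw [muOdd, Multiset.count_bind]
  change ∑ y ∈ T.toFinset.filter (fun x => Odd x), _ = _
  simp only [Multiset.count_replicate]
  rw [Finset.sum_ite_eq']
  simp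

theorem muOdd_sum_eq_two_iff (T : Multiset ℕ) :
    (muOdd T).sum = 2 ↔ muOdd T = ({1, 1} : Multiset ℕ) := by
  constructor
  · intro hs
    have h1 : ∀ y ∈ muOdd T, y = 1 := by
      intro y hy
      have hle := Multiset.le_sum_of_mem hy
      have hodd : Odd y := by
        by_contra hn
        have := Multiset.count_pos.2 hy
        rw [count_muOdd, if_neg (fun h => hn h.2)] at this
        omega
      obtain ⟨k, rfl⟩ := hodd
      omega
    have h2 := Multiset.eq_replicate_card.2 h1
    rw [h2, Multiset.sum_replicate, smul_eq_mul, mul_one] at hs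
    rw [h2, hs]
    rfl
  · intro h
    rw [h]
    rfl

theorem muOdd_eq_iff (T : Multiset ℕ) :
    muOdd T = ({1, 1} : Multiset ℕ) ↔
      0 < T.count 1 ∧ Even (T.count 1) ∧ ∀ x, Odd x → 3 ≤ x → T.count x = 0 := by
  have hc (x : ℕ) : ({1, 1} : Multiset ℕ).count x = if x = 1 then 2 else 0 := by
    change (Multiset.replicate 2 1).count x = _
    simp only [Multiset.count_replicate, eq_comm]
  simp only [Multiset.ext, count_muOdd, hc, ← Multiset.count_pos]
  constructor
  · intro h
    have h1 := h 1
    refine ⟨?_, ?_, fun x hx h3 => ?_⟩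
    · grind
    · grind
    · have := h x
      grind
  · rintro ⟨h1, h2, h3⟩ x
    by_cases hx : x = 1
    · subst hx
      simp [h1, h2]
    · rw [if_neg hx, if_neg]
      rintro ⟨hp, ho⟩
      have := h3 x ho (by obtain ⟨k, rfl⟩ := ho; omega)
      omega

/-- For `λ` a C-partition or D-partition of `n ≥ 1`:
`|μ(λ)| = 2` (equivalently `μ(λ) = (1,1)`) iff `λ₁ > λ₂`, `λ₁ - λ₂` is even,
and `λ_x = λ_{x+1}` for every odd `x ≥ 3`. -/
theorem statement10 (n : ℕ) (hn : 1 ≤ n) (l : Multiset ℕ)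
    (h : (IsTypeC l ∧ l.sum = 2 * n) ∨ (IsTypeD l ∧ l.sum = 2 * n)) :
    ((muOdd (transpose l)).sum = 2 ↔ muOdd (transpose l) = ({1, 1} : Multiset ℕ)) ∧
    ((muOdd (transpose l)).sum = 2 ↔
      (part l 2 < part l 1 ∧ Even (part l 1 - part l 2) ∧
        ∀ x, Odd x → 3 ≤ x → part l x = part l (x + 1))) := by
  refine ⟨muOdd_sum_eq_two_iff _, ?_⟩
  rw [muOdd_sum_eq_two_iff, muOdd_eq_iff, count_transpose l 1 le_rfl, Nat.sub_pos_iff_lt]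
  refine and_congr_right fun _ => and_congr_right fun _ =>
    forall_congr' fun x => forall_congr' fun _ => forall_congr' fun h3 => ?_
  rw [count_transpose l x (by omega)]
  have := part_anti l (show 1 ≤ x by omega) (show x ≤ x + 1 by omega)
  omega

end WFPaper
end
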